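/- Let 𝒳 be a separable real Hilbert space, (P_t)_{t≥0} a Markov transition semigroup on 𝒳, and Y a semi-dynamical system on 𝒳 with compact global attractor 𝒦. Assume the stochastic stability condition: for all ε, R, t > 0, inf_{‖x‖≤R} P_t(x, B(Y^x(t), ε)) > 0. Suppose B ⊆ 𝒳 is a bounded Borel set such that for every bounded Borel set D ⊆ 𝒳 there exists γ_D > 0 with liminf_{T→∞} Q^T(x, B) > γ_D for all x ∈ D. Then for every bounded Borel set D ⊆ 𝒳 and every r > 0 there exists w > 0 such that inf_{x∈D} liminf_{T→∞} Q^T(x, 𝒦 + rB(0,1)) > w. -/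

import Mathlib

open MeasureTheory Filter Topology Metric Set

noncomputable section

/-- A Markov transition semigroup on a measurable space `X`: a jointly measurable family
of Markov probability kernels `P t x` with `P 0 x = δ_x` and the Chapman–Kolmogorov
semigroup property for nonnegative times. -/
structure MarkovSemigroup (X : Type*) [MeasurableSpace X] where
  P : ℝ → X → MeasureTheory.Measure X
  prob : ∀ t x, MeasureTheory.IsProbabilityMeasure (P t x)
  meas : Measurable fun p : ℝ × X => P p.1 p.2
  init : ∀ x : X, P 0 x = MeasureTheory.Measure.dirac x
  semigroup : ∀ t s : ℝ, 0 ≤ t → 0 ≤ s → ∀ x : X,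
    P (t + s) x = (P t x).bind (P s)

namespace MarkovSemigroup

variable {X : Type*} [MeasurableSpace X]

/-- Action `P_t f(x) = ∫ f(y) P_t(x,dy)` on functions. -/
def act (M : MarkovSemigroup X) (t : ℝ) (f : X → ℝ) (x : X) : ℝ :=
  ∫ y, f y ∂(M.P t x)

/-- Dual action `P_t^* μ` on measures. -/
def dual (M : MarkovSemigroup X) (t : ℝ) (μ : MeasureTheory.Measure X) :
    MeasureTheory.Measure X :=
  μ.bind (M.P t)

/-- The time average `Q^T μ = (1/T) ∫_0^T P_s^* μ ds` (with the convention
`Q^T μ = μ` for `T ≤ 0`). -/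
def QM (M : MarkovSemigroup X) (T : ℝ) (μ : MeasureTheory.Measure X) :
    MeasureTheory.Measure X :=
  if T ≤ 0 then μ
  else ((ENNReal.ofReal (1 / T)) • (volume.restrict (Set.Ioc (0 : ℝ) T))).bind
    fun s => M.dual s μ

/-- `Q^T(x,·) := Q^T δ_x`. -/
def Q (M : MarkovSemigroup X) (T : ℝ) (x : X) : MeasureTheory.Measure X :=
  M.QM T (MeasureTheory.Measure.dirac x)

/-- Iterated averages: for `ts = [t_k, …, t_1]`, `QMs ts μ = Q^{t_k}(⋯(Q^{t_1} μ)⋯)`. -/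
def QMs (M : MarkovSemigroup X) (ts : List ℝ) (μ : MeasureTheory.Measure X) :
    MeasureTheory.Measure X :=
  ts.foldr (fun t ν => M.QM t ν) μ

/-- A measure is invariant if `P_t^* μ = μ` for all `t ≥ 0`. -/
def Invariant (M : MarkovSemigroup X) (μ : MeasureTheory.Measure X) : Prop :=
  ∀ t : ℝ, 0 ≤ t → M.dual t μ = μ

section TopologicalDefs

variable [TopologicalSpace X]

/-- Bounded continuous real functions. -/
def IsBddContinuous (f : X → ℝ) : Prop :=
  Continuous f ∧ ∃ C : ℝ, ∀ x, |f x| ≤ C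

/-- The Feller property: `P_t` maps bounded continuous functions to continuous ones. -/
def Feller (M : MarkovSemigroup X) : Prop :=
  ∀ t : ℝ, 0 ≤ t → ∀ f : X → ℝ, MarkovSemigroup.IsBddContinuous f →
    Continuous (M.act t f)

/-- Stochastic continuity: `P_t f(x) → f(x)` as `t → 0+`. -/
def StochasticallyContinuous (M : MarkovSemigroup X) : Prop :=
  ∀ f : X → ℝ, MarkovSemigroup.IsBddContinuous f → ∀ x : X,
    Filter.Tendsto (fun t : ℝ => M.act t f x) (nhdsWithin 0 (Set.Ioi 0)) (nhds (f x))

/-- Weak convergence of `Q^T ν` to `μ` as `T → ∞`. -/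
def QTendsto (M : MarkovSemigroup X) (ν μ : MeasureTheory.Measure X) : Prop :=
  ∀ f : X → ℝ, MarkovSemigroup.IsBddContinuous f →
    Filter.Tendsto (fun T : ℝ => ∫ x, f x ∂(M.QM T ν)) Filter.atTop
      (nhds (∫ x, f x ∂μ))

/-- Weak-* mean ergodicity with limit `μstar`. -/
def WeakStarMeanErgodic (M : MarkovSemigroup X) (μstar : MeasureTheory.Measure X) : Prop :=
  ∀ ν : MeasureTheory.Measure X, MeasureTheory.IsProbabilityMeasure ν → M.QTendsto ν μstar

/-- Tightness of the family `(Q^T(x,·))_{T>0}`. -/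
def TightAt (M : MarkovSemigroup X) (x : X) : Prop :=
  ∀ ε : ℝ, 0 < ε → ∃ K : Set X, IsCompact K ∧
    ∀ T : ℝ, 0 < T → 1 - ε ≤ ((M.Q T x) K).toReal

end TopologicalDefs

end MarkovSemigroup

/-- Topological support of a measure: points all of whose open neighborhoods
have positive mass. -/
def msupport {X : Type*} [MeasurableSpace X] [TopologicalSpace X]
    (μ : MeasureTheory.Measure X) : Set X :=
  {x : X | ∀ U : Set X, IsOpen U → x ∈ U → 0 < μ U}

/-- Total variation distance between two (finite) measures, as the supremum over
Borel sets of the discrepancy of masses. -/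
def tvDist {X : Type*} [MeasurableSpace X] (μ ν : MeasureTheory.Measure X) : ℝ :=
  ⨆ B : {B : Set X // MeasurableSet B}, |(μ B.1).toReal - (ν B.1).toReal|

section MetricDefs

variable {X : Type*} [MeasurableSpace X] [PseudoMetricSpace X]

/-- Bounded Lipschitz real functions. -/
def IsBddLipschitz (ψ : X → ℝ) : Prop :=
  (∃ K : NNReal, LipschitzWith K ψ) ∧ ∃ C : ℝ, ∀ x, |ψ x| ≤ C

/-- The e-property: equicontinuity of `(P_t ψ)_{t ≥ 0}` at every point, for every
bounded Lipschitz `ψ`. -/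
def MarkovSemigroup.EProperty (M : MarkovSemigroup X) : Prop :=
  ∀ ψ : X → ℝ, IsBddLipschitz ψ → ∀ x : X, ∀ ε : ℝ, 0 < ε →
    ∃ δ : ℝ, 0 < δ ∧ ∀ z : X, dist z x < δ → ∀ t : ℝ, 0 ≤ t →
      |M.act t ψ z - M.act t ψ x| < ε

end MetricDefs

namespace MarkovSemigroup

variable {X : Type*} [MeasurableSpace X]

lemma measurable_P (M : MarkovSemigroup X) (t : ℝ) : Measurable (M.P t) :=
  M.meas.comp measurable_prodMk_left

lemma measurable_P_apply_left (M : MarkovSemigroup X) (x : X) {A : Set X}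
    (hA : MeasurableSet A) : Measurable fun s => M.P s x A :=
  (Measure.measurable_coe hA).comp (M.meas.comp measurable_prodMk_right)

lemma dual_dirac (M : MarkovSemigroup X) (t : ℝ) (x : X) :
    M.dual t (Measure.dirac x) = M.P t x :=
  Measure.dirac_bind (M.measurable_P t) x

lemma Q_apply (M : MarkovSemigroup X) {T : ℝ} (hT : 0 < T) (x : X) {A : Set X}
    (hA : MeasurableSet A) :
    M.Q T x A = ENNReal.ofReal (1 / T) * ∫⁻ s in Ioc 0 T, M.P s x A := by
  have hm : Measurable fun s => M.P s x := M.meas.comp measurable_prodMk_right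
  simp only [Q, QM, if_neg hT.not_ge, dual_dirac]
  rw [Measure.bind_apply hA hm.aemeasurable, lintegral_smul_measure, smul_eq_mul]

lemma P_apply_le_one (M : MarkovSemigroup X) (t : ℝ) (x : X) (A : Set X) : M.P t x A ≤ 1 :=
  have := M.prob t x
  prob_le_one

lemma Q_apply_le_one (M : MarkovSemigroup X) {T : ℝ} (hT : 0 < T) (x : X) {A : Set X}
    (hA : MeasurableSet A) : M.Q T x A ≤ 1 := by
  rw [M.Q_apply hT x hA]
  calc ENNReal.ofReal (1 / T) * ∫⁻ s in Ioc 0 T, M.P s x A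
      ≤ ENNReal.ofReal (1 / T) * ∫⁻ _ in Ioc 0 T, 1 := by
        gcongr
        exact M.P_apply_le_one _ x A
    _ = 1 := by
        rw [setLIntegral_one, Real.volume_Ioc, sub_zero, ← ENNReal.ofReal_mul (by positivity),
          one_div_mul_cancel hT.ne', ENNReal.ofReal_one]

/-- A lower bound for the time-`t` transition from `B` to `U` transfers to later times. -/
lemma mul_P_apply_le_P_add (M : MarkovSemigroup X) {B U : Set X} (hB : MeasurableSet B)
    (hU : MeasurableSet U) {t : ℝ} (ht : 0 ≤ t) {c : ENNReal} (h : ∀ y ∈ B, c ≤ M.P t y U)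
    {s : ℝ} (hs : 0 ≤ s) (x : X) : c * M.P s x B ≤ M.P (s + t) x U := by
  rw [M.semigroup s t hs ht x, Measure.bind_apply hU (M.measurable_P t).aemeasurable,
    ← setLIntegral_const]
  exact (setLIntegral_mono' hB h).trans (setLIntegral_le_lintegral _ _)

/-- A lower bound for the time-`t` transition from `B` to `U` passes to time averages, up to
an error `t / T`. -/
lemma mul_Q_apply_le (M : MarkovSemigroup X) {B U : Set X} (hB : MeasurableSet B)
    (hU : MeasurableSet U) {t : ℝ} (ht : 0 ≤ t) {c : ENNReal} (h : ∀ y ∈ B, c ≤ M.P t y U)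
    {T : ℝ} (hT : 0 < T) (x : X) :
    c * M.Q T x B ≤ M.Q T x U + ENNReal.ofReal (t / T) := by
  have hshift : ∫⁻ s in Ioc 0 T, M.P (s + t) x U = ∫⁻ s in Ioc t (T + t), M.P s x U := by
    have := (measurePreserving_add_right volume t).setLIntegral_comp_preimage
      (measurableSet_Ioc (a := t) (b := T + t)) (M.measurable_P_apply_left x hU)
    simpa using this
  have key : c * ∫⁻ s in Ioc 0 T, M.P s x B
      ≤ (∫⁻ s in Ioc 0 T, M.P s x U) + ENNReal.ofReal t :=
    calc c * ∫⁻ s in Ioc 0 T, M.P s x B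
        = ∫⁻ s in Ioc 0 T, c * M.P s x B :=
          (lintegral_const_mul _ (M.measurable_P_apply_left x hB)).symm
      _ ≤ ∫⁻ s in Ioc 0 T, M.P (s + t) x U :=
          setLIntegral_mono' measurableSet_Ioc fun s hs =>
            M.mul_P_apply_le_P_add hB hU ht h hs.1.le x
      _ = ∫⁻ s in Ioc t (T + t), M.P s x U := hshift
      _ ≤ ∫⁻ s in Ioc 0 T ∪ Ioc T (T + t), M.P s x U := by
          refine lintegral_mono_set fun s hs => ?_
          rcases le_or_gt s T with hsT | hsT
          · exact Or.inl ⟨ht.trans_lt hs.1, hsT⟩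
          · exact Or.inr ⟨hsT, hs.2⟩
      _ ≤ (∫⁻ s in Ioc 0 T, M.P s x U) + ∫⁻ s in Ioc T (T + t), M.P s x U :=
          lintegral_union_le _ _ _
      _ ≤ (∫⁻ s in Ioc 0 T, M.P s x U) + ∫⁻ _ in Ioc T (T + t), 1 := by
          gcongr
          exact M.P_apply_le_one _ x U
      _ = (∫⁻ s in Ioc 0 T, M.P s x U) + ENNReal.ofReal t := by
          rw [setLIntegral_one, Real.volume_Ioc, add_sub_cancel_left]
  rw [M.Q_apply hT x hB, M.Q_apply hT x hU, mul_left_comm, div_eq_mul_one_div t T, mul_comm t,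
    ENNReal.ofReal_mul (by positivity), ← mul_add]
  gcongr

/-- A positive lower bound for the time-`t` transition from `B` to `U` turns an ergodic lower
bound for `B` into one for `U`. -/
lemma lt_liminf_Q_apply (M : MarkovSemigroup X) {B U : Set X} (hB : MeasurableSet B)
    (hU : MeasurableSet U) {t : ℝ} (ht : 0 ≤ t) {c : ℝ} (hc : 0 < c)
    (h : ∀ y ∈ B, ENNReal.ofReal c ≤ M.P t y U) {γ : ℝ} (hγ : 0 < γ) {x : X}
    (hx : γ < liminf (fun T : ℝ => (M.Q T x B).toReal) atTop) :
    c * γ / 4 < liminf (fun T : ℝ => (M.Q T x U).toReal) atTop := by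
  have hcγ : 0 < c * γ := mul_pos hc hγ
  have hev : ∀ᶠ T : ℝ in atTop, γ < (M.Q T x B).toReal :=
    eventually_lt_of_lt_liminf hx
      (isBoundedUnder_of_eventually_ge (a := 0) (Eventually.of_forall fun _ =>
        ENNReal.toReal_nonneg))
  have hsmall : ∀ᶠ T : ℝ in atTop, t / T < c * γ / 2 :=
    (tendsto_const_nhds.div_atTop tendsto_id).eventually_lt_const (half_pos hcγ)
  have hle_one : ∀ᶠ T : ℝ in atTop, (M.Q T x U).toReal ≤ 1 := by
    filter_upwards [eventually_gt_atTop 0] with T hT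
    exact ENNReal.toReal_le_of_le_ofReal zero_le_one (by simpa using M.Q_apply_le_one hT x hU)
  have hlow : ∀ᶠ T : ℝ in atTop, c * γ / 2 ≤ (M.Q T x U).toReal := by
    filter_upwards [hev, hsmall, eventually_gt_atTop 0] with T hT₁ hT₂ hT
    have hfin : M.Q T x U ≠ ⊤ := ((M.Q_apply_le_one hT x hU).trans_lt ENNReal.one_lt_top).ne
    have hreal := ENNReal.toReal_mono (ENNReal.add_ne_top.2 ⟨hfin, ENNReal.ofReal_ne_top⟩)
      (M.mul_Q_apply_le hB hU ht h hT x)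
    rw [ENNReal.toReal_mul, ENNReal.toReal_ofReal hc.le,
      ENNReal.toReal_add hfin ENNReal.ofReal_ne_top,
      ENNReal.toReal_ofReal (div_nonneg ht hT.le)] at hreal
    have := mul_lt_mul_of_pos_left hT₁ hc
    linarith
  calc c * γ / 4 < c * γ / 2 := by linarith
    _ ≤ _ := le_liminf_of_le
      (isBoundedUnder_of_eventually_le hle_one).isCoboundedUnder_ge hlow

end MarkovSemigroup

/-- Step III of the proof of Theorem 3. On a separable Hilbert space,
given a semi-dynamical system `Y` with compact global attractor `𝒦`, stochastic
stability, and a bounded Borel set `B` whose ergodic averages are bounded below on every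
bounded Borel set, for every bounded Borel set `D` and every `r > 0` there is `w > 0`
with `inf_{x∈D} liminf_T Q^T(x, 𝒦 + rB(0,1)) > w`. -/
theorem ergodic_lower_bound_of_attractor_neighborhoods
    {X : Type*} [NormedAddCommGroup X] [InnerProductSpace ℝ X] [CompleteSpace X]
    [SecondCountableTopology X] [MeasurableSpace X] [BorelSpace X]
    (M : MarkovSemigroup X)
    -- the semi-dynamical system
    (Y : X → ℝ → X)
    (hY0 : ∀ x, Y x 0 = x)
    (hYcont : ∀ x, ContinuousOn (Y x) (Set.Ici (0 : ℝ)))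
    (hYmeas : ∀ t : ℝ, 0 ≤ t → Measurable fun x => Y x t)
    (hYsemi : ∀ x : X, ∀ t : ℝ, 0 ≤ t → ∀ s : ℝ, 0 ≤ s → Y (Y x t) s = Y x (t + s))
    -- compact global attractor
    (K : Set X) (hKcpt : IsCompact K)
    (hKinv : ∀ x ∈ K, ∀ t : ℝ, 0 ≤ t → Y x t ∈ K)
    (hKattr : ∀ ε : ℝ, 0 < ε → ∀ R : ℝ, 0 < R → ∃ T : ℝ,
      ∀ x : X, ‖x‖ ≤ R → ∀ t : ℝ, T ≤ t → Y x t ∈ Metric.thickening ε K)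
    -- stochastic stability
    (hSS : ∀ ε : ℝ, 0 < ε → ∀ R : ℝ, 0 < R → ∀ t : ℝ, 0 < t →
      ∃ c : ℝ, 0 < c ∧ ∀ x : X, ‖x‖ ≤ R →
        ENNReal.ofReal c ≤ (M.P t x) (Metric.ball (Y x t) ε))
    -- the set B
    (B : Set X) (hBbd : Bornology.IsBounded B) (hBmeas : MeasurableSet B)
    (hB : ∀ D : Set X, Bornology.IsBounded D → MeasurableSet D →
      ∃ γ : ℝ, 0 < γ ∧ ∀ x ∈ D,
        γ < Filter.liminf (fun T : ℝ => ((M.Q T x) B).toReal) Filter.atTop) :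
    ∀ D : Set X, Bornology.IsBounded D → MeasurableSet D → ∀ r : ℝ, 0 < r →
      ∃ w : ℝ, 0 < w ∧ ∀ x ∈ D,
        w < Filter.liminf
          (fun T : ℝ => ((M.Q T x) (Metric.thickening r K)).toReal)
          Filter.atTop := by
  intro D hDbd hDmeas r hr
  obtain ⟨γ, hγ, hD⟩ := hB D hDbd hDmeas
  obtain ⟨R, hR, hBR⟩ := hBbd.exists_pos_norm_le
  obtain ⟨T, hT⟩ := hKattr (r / 2) (half_pos hr) R hR
  have ht : 0 < max T 1 := zero_lt_one.trans_le (le_max_right _ _)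
  obtain ⟨c, hc, hcP⟩ := hSS (r / 2) (half_pos hr) R hR (max T 1) ht
  have hstep : ∀ y ∈ B, ENNReal.ofReal c ≤ M.P (max T 1) y (thickening r K) := by
    intro y hy
    refine (hcP y (hBR y hy)).trans (measure_mono ?_)
    calc ball (Y y (max T 1)) (r / 2)
        ⊆ thickening (r / 2) (thickening (r / 2) K) :=
          ball_subset_thickening (hT y (hBR y hy) _ (le_max_left _ _)) _
      _ ⊆ thickening (r / 2 + r / 2) K := thickening_thickening_subset _ _ _
      _ = thickening r K := by rw [add_halves]
  exact ⟨c * γ / 4, by positivity, fun x hx =>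
    M.lt_liminf_Q_apply hBmeas isOpen_thickening.measurableSet ht.le hc hstep hγ (hD x hx)⟩
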